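/- Let D ∈ ℝ^{E×V}, let Γ ∈ ℝ^{V×V} and Λ ∈ ℝ^{E×E} be positive definite diagonal matrices with κ := ‖Γ^{1/2} Dᵀ Λ^{1/2}‖₂ ≤ 1, and Q = {x ∈ ℝ^V : x[i] = x̃_i for all i ∈ M} nonempty. Let (x̂^{(k)}, ŷ^{(k)})_{k≥0} be generated by the SLP update rule with x̂^{(−1)} = x̂^{(0)}, and let x̂_SLP ∈ Q be arbitrary. Then for every K ≥ 1, with x̄^{(K)} = (1/K) Σ_{k=1}^{K} x̂^{(k)}, ȳ^{(K)} = (1/K) Σ_{k=1}^{K} ŷ^{(k)}, and ỹ^{(K)} = sign(D x̄^{(K)}) (entrywise signum, sign(0)=0): (ỹ^{(K)})ᵀ D x̄^{(K)} − (ȳ^{(K)})ᵀ D x̂_SLP ≤ (1/(2K)) ( ‖x̂^{(0)} − x̂_SLP‖²_{Γ⁻¹} + ‖ŷ^{(0)} − ỹ^{(K)}‖²_{Λ⁻¹} ). -/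

import Mathlib

open Matrix Finset

noncomputable section

/-- The ℓ¹-norm of a finitely indexed real vector. -/
def l1Norm {ι : Type*} [Fintype ι] (u : ι → ℝ) : ℝ := ∑ i, |u i|

/-- The squared weighted norm `‖u‖²_Q = uᵀ Q u`. -/
def wnormSq {ι : Type*} [Fintype ι] (Q : Matrix ι ι ℝ) (u : ι → ℝ) : ℝ := u ⬝ᵥ (Q *ᵥ u)

/-- The closed ℓ∞ unit ball `{y : ‖y‖_∞ ≤ 1}`. -/
def linfBall (ι : Type*) : Set (ι → ℝ) := {y | ∀ e, |y e| ≤ 1}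

/-- `a` minimizes `f` over the set `S`. -/
def IsMinimizer {α : Type*} (S : Set α) (f : α → ℝ) (a : α) : Prop :=
  a ∈ S ∧ ∀ b ∈ S, f a ≤ f b

/-- Entrywise square root of the diagonal matrix with diagonal `g`. -/
def diagSqrt {ι : Type*} [Fintype ι] [DecidableEq ι] (g : ι → ℝ) : Matrix ι ι ℝ :=
  Matrix.diagonal (fun i => Real.sqrt (g i))

/-- The spectral norm `‖A‖₂ = sup_{‖u‖₂ = 1} ‖A u‖₂` of a real matrix. -/
def specNorm {m n : Type*} [Fintype m] [Fintype n] [DecidableEq n] (A : Matrix m n ℝ) : ℝ :=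
  ‖LinearMap.toContinuousLinearMap (Matrix.toEuclideanLin A)‖

/-- Objective of the dual resolvent step: `z ↦ ½ (ŷ + Λ D x̄ − z)ᵀ Λ⁻¹ (ŷ + Λ D x̄ − z)`. -/
def slpDualObj {V E : Type*} [Fintype V] [Fintype E] [DecidableEq E]
    (D : Matrix E V ℝ) (Λ : Matrix E E ℝ) (yk : E → ℝ) (xbar : V → ℝ) (z : E → ℝ) : ℝ :=
  (1/2) * wnormSq Λ⁻¹ (yk + Λ *ᵥ (D *ᵥ xbar) - z)

/-- Objective of the primal resolvent step: `z ↦ ½ (x̂ − Γ Dᵀ v − z)ᵀ Γ⁻¹ (x̂ − Γ Dᵀ v − z)`. -/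
def slpPrimalObj {V E : Type*} [Fintype V] [Fintype E] [DecidableEq V]
    (D : Matrix E V ℝ) (Γ : Matrix V V ℝ) (xk : V → ℝ) (v : E → ℝ) (z : V → ℝ) : ℝ :=
  (1/2) * wnormSq Γ⁻¹ (xk - Γ *ᵥ (Dᵀ *ᵥ v) - z)

/-- The SLP update rule: starting from `xs 0` (with `x^{(-1)} = x^{(0)}`, encoded via truncated
subtraction `0 - 1 = 0`) and `ys 0`, the iterate `ys (k+1)` minimizes the dual resolvent
objective over the ℓ∞ unit ball and `xs (k+1)` minimizes the primal resolvent objective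
over the constraint set `Q`. -/
def SLPSequences {V E : Type*} [Fintype V] [Fintype E] [DecidableEq V] [DecidableEq E]
    (D : Matrix E V ℝ) (Γ : Matrix V V ℝ) (Λ : Matrix E E ℝ) (Q : Set (V → ℝ))
    (xs : ℕ → V → ℝ) (ys : ℕ → E → ℝ) : Prop :=
  ∀ k : ℕ,
    IsMinimizer (linfBall E) (slpDualObj D Λ (ys k) ((2:ℝ) • xs k - xs (k-1))) (ys (k+1)) ∧
    IsMinimizer Q (slpPrimalObj D Γ (xs k) (ys (k+1))) (xs (k+1))

/-- An empirical graph: an undirected weighted graph together with a fixed orientation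
assigning each edge `e` a head `e⁺` and a tail `e⁻`, with positive weights, no self-loops,
and distinct edges joining distinct node pairs. -/
structure EmpiricalGraph (V E : Type*) where
  head : E → V
  tail : E → V
  w : E → ℝ
  w_pos : ∀ e, 0 < w e
  no_self_loop : ∀ e, head e ≠ tail e
  edge_inj : Function.Injective (fun e => ({head e, tail e} : Set V))

/-- The simple graph underlying an empirical graph. -/
def EmpiricalGraph.toSimpleGraph {V E : Type*} (G : EmpiricalGraph V E) : SimpleGraph V :=
  SimpleGraph.fromRel (fun i j => ∃ e, G.head e = i ∧ G.tail e = j)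

/-- Weighted node degree `d_i = ∑_{j ∈ N(i)} W_{i,j}`. -/
def EmpiricalGraph.deg {V E : Type*} [Fintype E] [DecidableEq V]
    (G : EmpiricalGraph V E) (i : V) : ℝ :=
  ∑ e, ((if G.head e = i then G.w e else 0) + (if G.tail e = i then G.w e else 0))

/-- Weighted oriented incidence matrix `D ∈ ℝ^{E×V}`: `D_{e,e⁺} = W_e`, `D_{e,e⁻} = −W_e`. -/
def EmpiricalGraph.incidence {V E : Type*} [DecidableEq V]
    (G : EmpiricalGraph V E) : Matrix E V ℝ :=
  Matrix.of fun e i => if G.head e = i then G.w e else if G.tail e = i then -G.w e else 0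


/-- The squared norm weighted by the inverse of a positive diagonal matrix, coordinatewise. -/
lemma wnormSq_inv_diagonal {ι : Type*} [Fintype ι] [DecidableEq ι] {g : ι → ℝ}
    (hg : ∀ i, 0 < g i) (u : ι → ℝ) :
    wnormSq (Matrix.diagonal g)⁻¹ u = ∑ i, u i ^ 2 / g i := by
  have hinv : (Matrix.diagonal g)⁻¹ = Matrix.diagonal (fun i => (g i)⁻¹) := by
    apply Matrix.inv_eq_right_inv
    rw [Matrix.diagonal_mul_diagonal, ← Matrix.diagonal_one]
    congr 1
    funext i
    exact mul_inv_cancel₀ (hg i).ne'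
  simp only [wnormSq, hinv, dotProduct, Matrix.mulVec_diagonal]
  exact Finset.sum_congr rfl fun i _ => by ring

lemma sum_sq_div_nonneg {ι : Type*} [Fintype ι] {g : ι → ℝ} (hg : ∀ i, 0 < g i) (u : ι → ℝ) :
    0 ≤ ∑ i, u i ^ 2 / g i :=
  Finset.sum_nonneg fun i _ => div_nonneg (sq_nonneg _) (hg i).le

/-- Variational inequality characterizing a weighted projection onto a convex set. -/
lemma IsMinimizer.sum_mul_div_nonpos {ι : Type*} [Fintype ι] [DecidableEq ι] {g : ι → ℝ}
    (hg : ∀ i, 0 < g i) {S : Set (ι → ℝ)} (hS : Convex ℝ S) {c p z : ι → ℝ}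
    (hp : IsMinimizer S (fun w => (1/2) * wnormSq (Matrix.diagonal g)⁻¹ (c - w)) p)
    (hz : z ∈ S) :
    ∑ i, (c i - p i) * (z i - p i) / g i ≤ 0 := by
  set B := ∑ i, (c i - p i) * (z i - p i) / g i with hB
  set A := ∑ i, (z i - p i) ^ 2 / g i with hA
  have hA0 : 0 ≤ A := sum_sq_div_nonneg hg (z - p)
  have key : ∀ t : ℝ, 0 ≤ t → t ≤ 1 → 0 ≤ -2 * t * B + t ^ 2 * A := by
    intro t h0 h1
    have hmem : p + t • (z - p) ∈ S := hS.add_smul_sub_mem hp.1 hz ⟨h0, h1⟩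
    have h := hp.2 _ hmem
    simp only [wnormSq_inv_diagonal hg] at h
    have expand : ∑ i, (c - (p + t • (z - p))) i ^ 2 / g i
        = ∑ i, (c - p) i ^ 2 / g i + (-2 * t * B + t ^ 2 * A) := by
      rw [hB, hA, Finset.mul_sum, Finset.mul_sum, ← Finset.sum_add_distrib,
        ← Finset.sum_add_distrib]
      refine Finset.sum_congr rfl fun i _ => ?_
      simp only [Pi.sub_apply, Pi.add_apply, Pi.smul_apply, smul_eq_mul]
      ring
    linarith
  by_contra! hpos
  have hden : 0 < A + B := by linarith
  have h := key (B / (A + B)) (by positivity) ((div_le_one hden).2 (by linarith))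
  have heq : -2 * (B / (A + B)) * B + (B / (A + B)) ^ 2 * A
      = -(B ^ 2 * (A + 2 * B)) / (A + B) ^ 2 := by
    field_simp
    ring
  rw [heq] at h
  have : 0 < B ^ 2 * (A + 2 * B) / (A + B) ^ 2 := by positivity
  rw [neg_div] at h
  linarith

/-- Three-point identity for a diagonally weighted inner product. -/
lemma sum_sub_mul_sub_div {ι : Type*} [Fintype ι] (g a b c : ι → ℝ) :
    ∑ i, (a i - b i) * (b i - c i) / g i
      = (1/2) * (∑ i, (a - c) i ^ 2 / g i - ∑ i, (b - c) i ^ 2 / g i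
          - ∑ i, (b - a) i ^ 2 / g i) := by
  rw [← Finset.sum_sub_distrib, ← Finset.sum_sub_distrib, Finset.mul_sum]
  refine Finset.sum_congr rfl fun i _ => ?_
  simp only [Pi.sub_apply]
  ring

lemma convex_linfBall (ι : Type*) : Convex ℝ (linfBall ι) := by
  intro x hx y hy a b ha hb hab e
  calc |(a • x + b • y) e| ≤ |a * x e| + |b * y e| := abs_add_le _ _
    _ = a * |x e| + b * |y e| := by rw [abs_mul, abs_mul, abs_of_nonneg ha, abs_of_nonneg hb]
    _ ≤ a * 1 + b * 1 := by gcongr <;> [exact hx e; exact hy e]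
    _ = 1 := by linarith

lemma convex_setOf_forall_mem_eq {ι : Type*} (M : Set ι) (c : ι → ℝ) :
    Convex ℝ {x : ι → ℝ | ∀ i ∈ M, x i = c i} := by
  intro x hx y hy a b _ _ hab i hi
  simp only [Pi.add_apply, Pi.smul_apply, smul_eq_mul, hx i hi, hy i hi]
  rw [← add_mul, hab, one_mul]

lemma dotProduct_mulVec_le_specNorm {m n : Type*} [Fintype m] [Fintype n] [DecidableEq n]
    (A : Matrix m n ℝ) (u : m → ℝ) (v : n → ℝ) :
    u ⬝ᵥ (A *ᵥ v) ≤ ‖WithLp.toLp 2 u‖ * (specNorm A * ‖WithLp.toLp 2 v‖) := by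
  have h1 : u ⬝ᵥ (A *ᵥ v) = inner ℝ (WithLp.toLp 2 u) (WithLp.toLp 2 (A *ᵥ v)) := by
    rw [EuclideanSpace.inner_toLp_toLp, dotProduct_comm]
    simp
  have h2 := (LinearMap.toContinuousLinearMap (Matrix.toEuclideanLin A)).le_opNorm
    (WithLp.toLp 2 v)
  have h3 : LinearMap.toContinuousLinearMap (Matrix.toEuclideanLin A) (WithLp.toLp 2 v)
      = WithLp.toLp 2 (A *ᵥ v) := rfl
  rw [h3] at h2
  rw [h1]
  exact (real_inner_le_norm _ _).trans (by gcongr; exact h2)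

lemma norm_sq_toLp_div_sqrt {ι : Type*} [Fintype ι] {g : ι → ℝ} (hg : ∀ i, 0 < g i) (u : ι → ℝ) :
    ‖WithLp.toLp 2 (fun i => u i / √(g i))‖ ^ 2 = ∑ i, u i ^ 2 / g i := by
  rw [EuclideanSpace.norm_sq_eq]
  refine Finset.sum_congr rfl fun i _ => ?_
  rw [Real.norm_eq_abs, sq_abs, div_pow, Real.sq_sqrt (hg i).le]

lemma diagSqrt_mulVec_div_sqrt {ι : Type*} [Fintype ι] [DecidableEq ι] {g : ι → ℝ}
    (hg : ∀ i, 0 < g i) (u : ι → ℝ) : diagSqrt g *ᵥ (fun i => u i / √(g i)) = u := by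
  funext i
  rw [diagSqrt, Matrix.mulVec_diagonal]
  exact mul_div_cancel₀ _ (Real.sqrt_pos.2 (hg i)).ne'

/-- Preconditioned Young inequality: if `‖Γ^{1/2} Dᵀ Λ^{1/2}‖₂ ≤ 1` then
`⟨e, D d⟩ ≤ ½ ‖d‖²_{Γ⁻¹} + ½ ‖e‖²_{Λ⁻¹}`. -/
lemma dotProduct_mulVec_le_of_specNorm_le_one {V E : Type*} [Fintype V] [Fintype E]
    [DecidableEq V] [DecidableEq E] {D : Matrix E V ℝ} {γ : V → ℝ} (hγ : ∀ i, 0 < γ i)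
    {lam : E → ℝ} (hlam : ∀ e, 0 < lam e)
    (hκ : specNorm (diagSqrt γ * Dᵀ * diagSqrt lam) ≤ 1) (d : V → ℝ) (e : E → ℝ) :
    e ⬝ᵥ (D *ᵥ d) ≤ (1/2) * ∑ i, d i ^ 2 / γ i + (1/2) * ∑ j, e j ^ 2 / lam j := by
  have hsymm : (fun i => d i / √(γ i)) ᵥ* diagSqrt γ = d := by
    rw [← Matrix.mulVec_transpose, diagSqrt, Matrix.diagonal_transpose]
    exact diagSqrt_mulVec_div_sqrt hγ d
  have heq : e ⬝ᵥ (D *ᵥ d) = (fun i => d i / √(γ i)) ⬝ᵥ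
      ((diagSqrt γ * Dᵀ * diagSqrt lam) *ᵥ (fun j => e j / √(lam j))) := by
    rw [← Matrix.mulVec_mulVec, diagSqrt_mulVec_div_sqrt hlam, ← Matrix.mulVec_mulVec,
      Matrix.mulVec_transpose, Matrix.dotProduct_mulVec, Matrix.dotProduct_mulVec, hsymm,
      dotProduct_comm]
  have h := dotProduct_mulVec_le_specNorm (diagSqrt γ * Dᵀ * diagSqrt lam)
    (fun i => d i / √(γ i)) (fun j => e j / √(lam j))
  rw [← heq] at h
  rw [← norm_sq_toLp_div_sqrt hγ, ← norm_sq_toLp_div_sqrt hlam]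
  set a := ‖WithLp.toLp 2 (fun i => d i / √(γ i))‖
  set b := ‖WithLp.toLp 2 (fun j => e j / √(lam j))‖
  have hb : specNorm (diagSqrt γ * Dᵀ * diagSqrt lam) * b ≤ b :=
    mul_le_of_le_one_left (norm_nonneg _) hκ
  have hab := h.trans (mul_le_mul_of_nonneg_left hb (norm_nonneg _))
  nlinarith [sq_nonneg (a - b)]

/-- The Lyapunov function whose decrease along SLP bounds the primal-dual gap at `(x, y)`. -/
def slpPotential {V E : Type*} [Fintype V] [Fintype E]
    (D : Matrix E V ℝ) (γ : V → ℝ) (lam : E → ℝ) (xs : ℕ → V → ℝ) (ys : ℕ → E → ℝ)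
    (x : V → ℝ) (y : E → ℝ) (k : ℕ) : ℝ :=
  (1/2) * ∑ i, (xs k - x) i ^ 2 / γ i + (1/2) * ∑ e, (ys k - y) e ^ 2 / lam e
    + (1/2) * ∑ i, (xs k - xs (k-1)) i ^ 2 / γ i
    - (y - ys k) ⬝ᵥ (D *ᵥ (xs k - xs (k-1)))

section

variable {V E : Type*} [Fintype V] [Fintype E] [DecidableEq V] [DecidableEq E]
  {D : Matrix E V ℝ} {γ : V → ℝ} {lam : E → ℝ} {Q : Set (V → ℝ)}
  {xs : ℕ → V → ℝ} {ys : ℕ → E → ℝ} {x : V → ℝ} {y : E → ℝ}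

lemma slpPotential_nonneg (hγ : ∀ i, 0 < γ i) (hlam : ∀ e, 0 < lam e)
    (hκ : specNorm (diagSqrt γ * Dᵀ * diagSqrt lam) ≤ 1) (k : ℕ) :
    0 ≤ slpPotential D γ lam xs ys x y k := by
  have h := dotProduct_mulVec_le_of_specNorm_le_one hγ hlam hκ (xs k - xs (k-1)) (y - ys k)
  have hx := sum_sq_div_nonneg hγ (xs k - x)
  have hy : ∑ e, (y - ys k) e ^ 2 / lam e = ∑ e, (ys k - y) e ^ 2 / lam e :=
    Finset.sum_congr rfl fun e _ => by simp only [Pi.sub_apply]; ring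
  rw [hy] at h
  unfold slpPotential
  linarith

/-- The primal-dual gap after one SLP step is at most the decrease of the potential. -/
lemma SLPSequences.gap_le (hγ : ∀ i, 0 < γ i) (hlam : ∀ e, 0 < lam e)
    (hκ : specNorm (diagSqrt γ * Dᵀ * diagSqrt lam) ≤ 1) (hQ : Convex ℝ Q)
    (hseq : SLPSequences D (Matrix.diagonal γ) (Matrix.diagonal lam) Q xs ys)
    (hx : x ∈ Q) (hy : y ∈ linfBall E) (k : ℕ) :
    y ⬝ᵥ (D *ᵥ xs (k+1)) - ys (k+1) ⬝ᵥ (D *ᵥ x) ≤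
      slpPotential D γ lam xs ys x y k - slpPotential D γ lam xs ys x y (k+1) := by
  have hdual := IsMinimizer.sum_mul_div_nonpos hlam (convex_linfBall E) (hseq k).1 hy
  have hprimal := IsMinimizer.sum_mul_div_nonpos hγ hQ (hseq k).2 hx
  have hdual_eq : ∑ e, ((ys k + Matrix.diagonal lam *ᵥ (D *ᵥ ((2:ℝ) • xs k - xs (k-1)))) e
        - ys (k+1) e) * (y e - ys (k+1) e) / lam e
      = -(∑ e, (ys k e - ys (k+1) e) * (ys (k+1) e - y e) / lam e)
        + (y - ys (k+1)) ⬝ᵥ (D *ᵥ ((2:ℝ) • xs k - xs (k-1))) := by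
    rw [dotProduct, ← Finset.sum_neg_distrib, ← Finset.sum_add_distrib]
    refine Finset.sum_congr rfl fun e _ => ?_
    have := (hlam e).ne'
    simp only [Pi.sub_apply, Pi.add_apply, Matrix.mulVec_diagonal]
    field_simp
    ring
  have hprimal_eq : ∑ i, ((xs k - Matrix.diagonal γ *ᵥ (Dᵀ *ᵥ ys (k+1))) i
        - xs (k+1) i) * (x i - xs (k+1) i) / γ i
      = -(∑ i, (xs k i - xs (k+1) i) * (xs (k+1) i - x i) / γ i)
        + ys (k+1) ⬝ᵥ (D *ᵥ (xs (k+1) - x)) := by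
    rw [Matrix.dotProduct_mulVec, ← Matrix.mulVec_transpose, dotProduct,
      ← Finset.sum_neg_distrib, ← Finset.sum_add_distrib]
    refine Finset.sum_congr rfl fun i _ => ?_
    have := (hγ i).ne'
    simp only [Pi.sub_apply, Matrix.mulVec_diagonal]
    field_simp
    ring
  rw [hdual_eq, sum_sub_mul_sub_div] at hdual
  rw [hprimal_eq, sum_sub_mul_sub_div] at hprimal
  have hcross := dotProduct_mulVec_le_of_specNorm_le_one hγ hlam hκ
    (xs k - xs (k-1)) (ys (k+1) - ys k)
  unfold slpPotential
  simp only [Nat.add_sub_cancel]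
  simp only [Matrix.mulVec_sub, Matrix.mulVec_smul, dotProduct_sub, sub_dotProduct,
    dotProduct_smul, smul_eq_mul] at hdual hprimal hcross ⊢
  linarith

lemma SLPSequences.sum_gap_le (hγ : ∀ i, 0 < γ i) (hlam : ∀ e, 0 < lam e)
    (hκ : specNorm (diagSqrt γ * Dᵀ * diagSqrt lam) ≤ 1) (hQ : Convex ℝ Q)
    (hseq : SLPSequences D (Matrix.diagonal γ) (Matrix.diagonal lam) Q xs ys)
    (hx : x ∈ Q) (hy : y ∈ linfBall E) (K : ℕ) :
    ∑ k ∈ Finset.Icc 1 K, (y ⬝ᵥ (D *ᵥ xs k) - ys k ⬝ᵥ (D *ᵥ x)) ≤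
      slpPotential D γ lam xs ys x y 0 - slpPotential D γ lam xs ys x y K := by
  induction K with
  | zero => simp
  | succ K ih =>
    rw [Finset.sum_Icc_succ_top (by lia)]
    linarith [hseq.gap_le hγ hlam hκ hQ hx hy K]

/-- The averaged SLP iterates have primal-dual gap `O(1/K)` at every feasible point. -/
lemma SLPSequences.averaged_gap_le (hγ : ∀ i, 0 < γ i) (hlam : ∀ e, 0 < lam e)
    (hκ : specNorm (diagSqrt γ * Dᵀ * diagSqrt lam) ≤ 1) (hQ : Convex ℝ Q)
    (hseq : SLPSequences D (Matrix.diagonal γ) (Matrix.diagonal lam) Q xs ys)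
    (hx : x ∈ Q) (hy : y ∈ linfBall E) (K : ℕ) :
    y ⬝ᵥ (D *ᵥ ((K : ℝ)⁻¹ • ∑ k ∈ Finset.Icc 1 K, xs k))
        - ((K : ℝ)⁻¹ • ∑ k ∈ Finset.Icc 1 K, ys k) ⬝ᵥ (D *ᵥ x) ≤
      (1 / (2 * K)) * (wnormSq (Matrix.diagonal γ)⁻¹ (xs 0 - x)
        + wnormSq (Matrix.diagonal lam)⁻¹ (ys 0 - y)) := by
  have hsum := hseq.sum_gap_le hγ hlam hκ hQ hx hy K
  have hK := slpPotential_nonneg (xs := xs) (ys := ys) (x := x) (y := y) hγ hlam hκ K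
  have h0 : slpPotential D γ lam xs ys x y 0
      = (1/2) * (wnormSq (Matrix.diagonal γ)⁻¹ (xs 0 - x)
        + wnormSq (Matrix.diagonal lam)⁻¹ (ys 0 - y)) := by
    rw [wnormSq_inv_diagonal hγ, wnormSq_inv_diagonal hlam, slpPotential]
    simp
    ring
  have hlhs : y ⬝ᵥ (D *ᵥ ((K : ℝ)⁻¹ • ∑ k ∈ Finset.Icc 1 K, xs k))
        - ((K : ℝ)⁻¹ • ∑ k ∈ Finset.Icc 1 K, ys k) ⬝ᵥ (D *ᵥ x)
      = (K : ℝ)⁻¹ * ∑ k ∈ Finset.Icc 1 K, (y ⬝ᵥ (D *ᵥ xs k) - ys k ⬝ᵥ (D *ᵥ x)) := by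
    rw [Matrix.mulVec_smul, dotProduct_smul, smul_dotProduct, Matrix.mulVec_sum,
      dotProduct_sum, sum_dotProduct, Finset.sum_sub_distrib, smul_eq_mul, smul_eq_mul, mul_sub]
  have hrhs : 1 / (2 * (K : ℝ)) = (K : ℝ)⁻¹ * (1/2) := by
    rw [one_div, mul_inv]
    ring
  rw [hlhs, hrhs, mul_assoc, ← h0]
  gcongr
  linarith

end

/-- averaged primal-dual gap bound for SLP. With `κ = ‖Γ^{1/2}DᵀΛ^{1/2}‖₂ ≤ 1`,
SLP iterates started from `x̂⁽⁻¹⁾ = x̂⁽⁰⁾`, and arbitrary `x̂_SLP ∈ Q`, for every `K ≥ 1` and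
`x̄⁽ᴷ⁾, ȳ⁽ᴷ⁾` the averaged iterates and `ỹ⁽ᴷ⁾ = sign(D x̄⁽ᴷ⁾)`:
`(ỹ⁽ᴷ⁾)ᵀDx̄⁽ᴷ⁾ − (ȳ⁽ᴷ⁾)ᵀDx̂_SLP ≤ (1/(2K))(‖x̂⁽⁰⁾ − x̂_SLP‖²_{Γ⁻¹} + ‖ŷ⁽⁰⁾ − ỹ⁽ᴷ⁾‖²_{Λ⁻¹})`. -/
theorem slp_averaged_gap_bound
    {V E : Type*} [Fintype V] [Fintype E] [DecidableEq V] [DecidableEq E]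
    (D : Matrix E V ℝ)
    (γ : V → ℝ) (hγ : ∀ i, 0 < γ i) (lam : E → ℝ) (hlam : ∀ e, 0 < lam e)
    (κ : ℝ) (hκ : κ = specNorm (diagSqrt γ * Dᵀ * diagSqrt lam)) (hκ1 : κ ≤ 1)
    (M : Set V) (xtil : V → ℝ)
    (Q : Set (V → ℝ)) (hQ : Q = {x : V → ℝ | ∀ i ∈ M, x i = xtil i})
    (hQne : Q.Nonempty)
    (xs : ℕ → V → ℝ) (ys : ℕ → E → ℝ)
    (hseq : SLPSequences D (Matrix.diagonal γ) (Matrix.diagonal lam) Q xs ys)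
    (xSLP : V → ℝ) (hxQ : xSLP ∈ Q) :
    ∀ K : ℕ, 1 ≤ K →
      (fun e => Real.sign ((D *ᵥ ((K : ℝ)⁻¹ • ∑ k ∈ Finset.Icc 1 K, xs k)) e)) ⬝ᵥ
            (D *ᵥ ((K : ℝ)⁻¹ • ∑ k ∈ Finset.Icc 1 K, xs k)) -
          ((K : ℝ)⁻¹ • ∑ k ∈ Finset.Icc 1 K, ys k) ⬝ᵥ (D *ᵥ xSLP) ≤
        (1 / (2 * K)) *
          (wnormSq (Matrix.diagonal γ)⁻¹ (xs 0 - xSLP) +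
            wnormSq (Matrix.diagonal lam)⁻¹
              (ys 0 - fun e =>
                Real.sign ((D *ᵥ ((K : ℝ)⁻¹ • ∑ k ∈ Finset.Icc 1 K, xs k)) e))) := by
  intro K _
  subst hQ
  refine hseq.averaged_gap_le hγ hlam (hκ ▸ hκ1) (convex_setOf_forall_mem_eq M xtil) hxQ
    (fun e => ?_) K
  rcases Real.sign_apply_eq
    ((D *ᵥ ((K : ℝ)⁻¹ • ∑ k ∈ Finset.Icc 1 K, xs k)) e) with h | h | h <;> simp [h]

end
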